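/- arXiv:2009.02074 — 2 statements merged into one kernel-verified Lean document; each statement's English description precedes it below -/
import Mathlib

section
/- Let G be a normal subgroup of a finite group G̃ with G̃/G abelian, and let χ be the character of an irreducible complex representation of G. Assume χ extends to its stabilizer G̃_χ. Then the irreducible characters of G̃ lying over χ form a single orbit under multiplication by linear characters of G̃ trivial on G: (a) for any two irreducible characters χ̃₁, χ̃₂ of G̃ lying over χ there exists a homomorphism μ : G̃ → ℂˣ with G ≤ ker(μ) such that χ̃₂ = χ̃₁·μ; and (b) conversely, for every such μ the product χ̃₁·μ is an irreducible character of G̃ lying over χ. -/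
open CategoryTheory

universe u v

namespace FDRep

open scoped ComplexOrder in
/-- The values of a complex character of a finite group at inverse elements are conjugate. -/
theorem char_inv_eq_conj {G : Type*} [Group G] [Finite G] (V : FDRep ℂ G) (g : G) :
    V.character g⁻¹ = starRingEnd ℂ (V.character g) := by
  classical
  have := Fintype.ofFinite G
  let b := Module.finBasis ℂ V
  let M : G → Matrix _ _ ℂ := fun x ↦ LinearMap.toMatrix b b (V.ρ x)
  have hmul (x y : G) : M (x * y) = M x * M y := by
    simp only [M, map_mul, LinearMap.toMatrix_mul]
  have hone : M 1 = 1 := by simp [M, LinearMap.toMatrix_one]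
  have hchar (x : G) : V.character x = (M x).trace :=
    LinearMap.trace_eq_matrix_trace ℂ b (V.ρ x)
  have hunit (x : G) : IsUnit (M x) :=
    IsUnit.of_mul_eq_one (M x⁻¹) (by rw [← hmul, mul_inv_cancel, hone])
  -- `P` is the Gram matrix of an invariant inner product.
  let P := ∑ x : G, (M x).conjTranspose * M x
  have hP : P.PosDef := Matrix.posDef_sum Finset.univ_nonempty fun x _ ↦
    Matrix.PosDef.conjTranspose_mul_self _ (Matrix.mulVec_injective_iff_isUnit.mpr (hunit x))
  have hdet : IsUnit P.det := (Matrix.isUnit_iff_isUnit_det P).mp hP.isUnit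
  have hinv : (M g).conjTranspose * P * M g = P := by
    simp only [P, Finset.mul_sum, Finset.sum_mul]
    refine Fintype.sum_equiv (Equiv.mulRight g) _ _ fun x ↦ ?_
    simp only [Equiv.coe_mulRight, hmul, Matrix.conjTranspose_mul, Matrix.mul_assoc]
  have hconj : (M g).conjTranspose * P = P * M g⁻¹ := by
    calc (M g).conjTranspose * P = (M g).conjTranspose * P * (M g * M g⁻¹) := by
          rw [← hmul, mul_inv_cancel, hone, mul_one]
      _ = P * M g⁻¹ := by rw [← Matrix.mul_assoc, hinv]
  rw [hchar, hchar, starRingEnd_apply, ← Matrix.trace_conjTranspose,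
    ← Matrix.mul_nonsing_inv_cancel_right P (M g).conjTranspose hdet, hconj, Matrix.trace_mul_comm,
    ← Matrix.mul_assoc, Matrix.nonsing_inv_mul P hdet, one_mul]

section Twist

variable {k G : Type*} [Field k] [Group G]

/-- The product of a representation with a linear character. -/
noncomputable def twist (V : FDRep k G) (μ : G →* kˣ) : FDRep k G :=
  FDRep.of (V := V)
    { toFun := fun g ↦ (μ g : k) • V.ρ g
      map_one' := by simp
      map_mul' := fun x y ↦ by simp [mul_smul, smul_comm (μ x : k)] }

theorem char_twist (V : FDRep k G) (μ : G →* kˣ) (g : G) :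
    (V.twist μ).character g = V.character g * (μ g : k) := by
  simp only [character]
  rw [mul_comm, ← smul_eq_mul, ← map_smul]
  rfl

/-- The restriction of a representation to a subgroup. -/
noncomputable def res (V : FDRep k G) (H : Subgroup G) : FDRep k H :=
  FDRep.of (V := V) (V.ρ.comp H.subtype)

theorem char_res (V : FDRep k G) (H : Subgroup G) (x : H) :
    (V.res H).character x = V.character (x : G) :=
  rfl

end Twist

theorem simple_twist {k G : Type u} [Field k] [IsAlgClosed k] [CharZero k] [Group G] [Finite G]
    (V : FDRep k G) (hV : Simple V) (μ : G →* kˣ) : Simple (V.twist μ) := by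
  have := Fintype.ofFinite G
  rw [simple_iff_char_is_norm_one] at hV ⊢
  rw [← hV]
  refine Finset.sum_congr rfl fun g _ ↦ ?_
  rw [char_twist, char_twist, mul_mul_mul_comm, ← Units.val_mul, ← map_mul]
  simp

section ScalarProduct

variable {k : Type u} {G : Type v} [Field k] [CharZero k] [Group G] [Fintype G]

theorem sum_char_mul_char_inv_ne_zero_iff (V W : FDRep k G) :
    ∑ g : G, W.character g * V.character g⁻¹ ≠ 0 ↔ ∃ f : V ⟶ W, f ≠ 0 := by
  have hc : (Nat.card G : k) ≠ 0 := Nat.cast_ne_zero.mpr Nat.card_pos.ne'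
  have := invertibleOfNonzero hc
  have h := scalar_product_char_eq_finrank_equivariant V W
  rw [← nontrivial_iff_exists_ne, ← Module.finrank_pos_iff (R := k), pos_iff_ne_zero,
    ← Nat.cast_ne_zero (R := k), ← h, mul_ne_zero_iff]
  simp

/-- Two representations with a common simple constituent are not orthogonal. -/
theorem sum_char_mul_char_inv_ne_zero_of_simple {U V W : FDRep k G} [Simple U]
    (hV : ∑ g : G, V.character g * U.character g⁻¹ ≠ 0)
    (hW : ∑ g : G, W.character g * U.character g⁻¹ ≠ 0) :
    ∑ g : G, W.character g * V.character g⁻¹ ≠ 0 := by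
  have hV' : ∑ g : G, U.character g * V.character g⁻¹ ≠ 0 := by
    convert! hV using 1
    exact Fintype.sum_equiv (Equiv.inv G) _ _ fun g ↦ by simp [mul_comm]
  obtain ⟨p, hp⟩ := (sum_char_mul_char_inv_ne_zero_iff V U).mp hV'
  obtain ⟨i, hi⟩ := (sum_char_mul_char_inv_ne_zero_iff U W).mp hW
  have := epi_of_nonzero_to_simple hp
  exact (sum_char_mul_char_inv_ne_zero_iff V W).mpr
    ⟨p ≫ i, fun h ↦ hi ((cancel_epi p).mp (h.trans Limits.comp_zero.symm))⟩

end ScalarProduct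

theorem char_eq_of_sum_ne_zero {k : Type u} {G : Type v} [Field k] [IsAlgClosed k] [CharZero k]
    [Group G] [Fintype G] (V W : FDRep k G) [Simple V] [Simple W]
    (h : ∑ g : G, V.character g * W.character g⁻¹ ≠ 0) : V.character = W.character := by
  have hc : (Nat.card G : k) ≠ 0 := Nat.cast_ne_zero.mpr Nat.card_pos.ne'
  have := invertibleOfNonzero hc
  have horth := char_orthonormal V W
  split_ifs at horth with hiso
  · exact char_iso hiso.some
  · exact absurd horth (mul_ne_zero (inv_ne_zero hc) h)

end FDRep

theorem CommGroup.sum_monoidHom_units_apply {A R : Type*} [CommGroup A] [Finite A] [CommRing R]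
    [IsDomain R] [HasEnoughRootsOfUnity R (Monoid.exponent A)] [Fintype (A →* Rˣ)]
    [DecidableEq A] (a : A) :
    ∑ φ : A →* Rˣ, (φ a : R) = if a = 1 then (Fintype.card (A →* Rˣ) : R) else 0 := by
  split_ifs with ha
  · simp [ha]
  · obtain ⟨ψ, hψ⟩ := CommGroup.exists_apply_ne_one_of_hasEnoughRootsOfUnity A R ha
    have h : (ψ a : R) * ∑ φ : A →* Rˣ, (φ a : R) = ∑ φ : A →* Rˣ, (φ a : R) := by
      rw [Finset.mul_sum]
      exact Fintype.sum_equiv (Equiv.mulLeft ψ) _ _ fun φ ↦ by simp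
    exact eq_zero_of_mul_eq_self_left (by simpa using hψ) h

/-- Two irreducible characters of `T` whose restrictions to `H` are not orthogonal differ by a
linear character trivial on `H`, if `T ⧸ H` is abelian. -/
theorem FDRep.exists_char_eq_mul_of_sum_res_ne_zero {T : Type} [Group T] [Finite T]
    (H : Subgroup T) [Fintype H] [H.Normal] (hab : ∀ a b : T ⧸ H, a * b = b * a)
    (V₁ V₂ : FDRep ℂ T) (h₁ : Simple V₁) (h₂ : Simple V₂)
    (h : ∑ x : H, V₂.character (x : T) * V₁.character (x : T)⁻¹ ≠ 0) :
    ∃ μ : T →* ℂˣ, H ≤ μ.ker ∧ ∀ t : T, V₂.character t = V₁.character t * (μ t : ℂ) := by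
  classical
  have := Fintype.ofFinite T
  let _ : CommGroup (T ⧸ H) := { (inferInstance : Group (T ⧸ H)) with mul_comm := hab }
  have := Fintype.ofFinite ((T ⧸ H) →* ℂˣ)
  let c : ℂ := Fintype.card ((T ⧸ H) →* ℂˣ)
  have hc : c ≠ 0 := Nat.cast_ne_zero.mpr Fintype.card_ne_zero
  let infl (ν : (T ⧸ H) →* ℂˣ) : T →* ℂˣ := ν.comp (QuotientGroup.mk' H)
  have hsum : ∑ ν : (T ⧸ H) →* ℂˣ,
      ∑ t : T, V₂.character t * (V₁.twist (infl ν)).character t⁻¹ ≠ 0 := by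
    have hH : ∑ x : H, V₂.character (x : T) * V₁.character (x : T)⁻¹ =
        ∑ t : T with t ∈ H, V₂.character t * V₁.character t⁻¹ :=
      (Finset.sum_subtype _ (by simp) fun t ↦ V₂.character t * V₁.character t⁻¹).symm
    convert! mul_ne_zero h hc using 1
    rw [hH, Finset.sum_comm, Finset.sum_filter, Finset.sum_mul]
    refine Finset.sum_congr rfl fun t _ ↦ ?_
    simp only [char_twist, ← mul_assoc, ← Finset.mul_sum, infl, MonoidHom.comp_apply]
    rw [CommGroup.sum_monoidHom_units_apply]
    simp [c]
  obtain ⟨ν, -, hν⟩ := Finset.exists_ne_zero_of_sum_ne_zero hsum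
  have := V₁.simple_twist h₁ (infl ν)
  refine ⟨infl ν, fun x hx ↦ ?_, fun t ↦ ?_⟩
  · simp [infl, MonoidHom.mem_ker, (QuotientGroup.eq_one_iff x).mpr hx]
  · rw [char_eq_of_sum_ne_zero V₂ (V₁.twist (infl ν)) hν, char_twist]

/-- Let `H ⊴ T` with `T/H` abelian, and let `χ` (the character of the
simple complex representation `V` of `H`) extend to its stabilizer `S = T_χ`.  Then the
irreducible characters of `T` lying over `χ` form a single orbit under multiplication by
linear characters of `T` trivial on `H`:
(a) for any two simple representations `V₁, V₂` of `T` whose characters lie over `χ`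
there is a homomorphism `μ : T → ℂˣ` trivial on `H` with `χ_{V₂} = χ_{V₁}·μ`; and
(b) conversely, for every such `μ` the product `χ_{V₁}·μ` is again the character of an
irreducible representation of `T` lying over `χ`. -/
theorem irr_over_single_lin_orbit {T : Type} [Group T] [Finite T]
    (H : Subgroup T) [H.Normal] (hab : ∀ a b : T ⧸ H, a * b = b * a)
    (V : FDRep ℂ H) (hV : Simple V)
    (S : Subgroup T)
    (hS : ∀ g : T, g ∈ S ↔ ∀ x : H, V.character (MulAut.conjNormal g x) = V.character x)
    (hHS : H ≤ S)
    (hext : ∃ W : FDRep ℂ S, Simple W ∧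
      ∀ (x : T) (hx : x ∈ H), W.character ⟨x, hHS hx⟩ = V.character ⟨x, hx⟩) :
    (∀ V₁ V₂ : FDRep ℂ T, Simple V₁ → Simple V₂ →
      (∑ᶠ x : H, V₁.character (x : T) * (starRingEnd ℂ) (V.character x)) ≠ 0 →
      (∑ᶠ x : H, V₂.character (x : T) * (starRingEnd ℂ) (V.character x)) ≠ 0 →
      ∃ μ : T →* ℂˣ, H ≤ μ.ker ∧
        ∀ t : T, V₂.character t = V₁.character t * (μ t : ℂ)) ∧
    (∀ V₁ : FDRep ℂ T, Simple V₁ →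
      (∑ᶠ x : H, V₁.character (x : T) * (starRingEnd ℂ) (V.character x)) ≠ 0 →
      ∀ μ : T →* ℂˣ, H ≤ μ.ker →
      ∃ V₃ : FDRep ℂ T, Simple V₃ ∧
        (∀ t : T, V₃.character t = V₁.character t * (μ t : ℂ)) ∧
        (∑ᶠ x : H, V₃.character (x : T) * (starRingEnd ℂ) (V.character x)) ≠ 0) := by
  have := Fintype.ofFinite H
  simp only [finsum_eq_sum_of_fintype, ← FDRep.char_inv_eq_conj]
  refine ⟨fun V₁ V₂ h₁ h₂ hV₁ hV₂ ↦ ?_, fun V₁ h₁ hV₁ μ hμ ↦ ?_⟩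
  · exact FDRep.exists_char_eq_mul_of_sum_res_ne_zero H hab V₁ V₂ h₁ h₂
      (FDRep.sum_char_mul_char_inv_ne_zero_of_simple (U := V) (V := V₁.res H) (W := V₂.res H)
        hV₁ hV₂)
  · refine ⟨V₁.twist μ, V₁.simple_twist h₁ μ, V₁.char_twist μ, ?_⟩
    have hμ' (x : H) : μ x = 1 := hμ x.2
    simpa [FDRep.char_twist, hμ'] using hV₁
end

section
/- Let G be a normal subgroup of a finite group G̃ with G̃/G abelian, let χ be the character of an irreducible complex representation of G that extends to its stabilizer G̃_χ, and let χ̃ be an irreducible character of G̃ lying over χ. Then G̃_χ = ⋂ ker(μ), where the intersection runs over all homomorphisms μ : G̃ → ℂˣ with G ≤ ker(μ) and χ̃·μ = χ̃. -/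
open CategoryTheory

namespace Representation

open Module

section Irreducible

variable {k G V : Type*} [Monoid G] [Field k] [AddCommGroup V] [Module k V]

theorem IsIrreducible.nontrivial (ρ : Representation k G V) [IsIrreducible ρ] : Nontrivial V := by
  by_contra h
  rw [not_nontrivial_iff_subsingleton] at h
  exact bot_ne_top (α := Subrepresentation ρ) (SetLike.ext fun v => by
    rw [Subsingleton.elim v 0]
    exact iff_of_true (Submodule.zero_mem _) (Submodule.zero_mem _))

theorem IsIrreducible.eq_top_of_mem (ρ : Representation k G V) [IsIrreducible ρ]
    (p : Submodule k V) (hp : ∀ g, ∀ v ∈ p, ρ g v ∈ p) {v : V} (hv : v ∈ p) (hv0 : v ≠ 0) :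
    p = ⊤ := by
  rcases eq_bot_or_eq_top (⟨p, fun g v h => hp g v h⟩ : Subrepresentation ρ) with h | h
  · have : v ∈ (⟨p, fun g v h => hp g v h⟩ : Subrepresentation ρ) := hv
    rw [h] at this
    exact absurd this hv0
  · exact congrArg Subrepresentation.toSubmodule h

theorem IsIrreducible.of_forall_eq_top [Nontrivial V] (ρ : Representation k G V)
    (h : ∀ p : Submodule k V, (∀ g, ∀ v ∈ p, ρ g v ∈ p) → p ≠ ⊥ → p = ⊤) : IsIrreducible ρ where
  exists_pair_ne := ⟨⊥, ⊤, fun h => bot_ne_top (congrArg Subrepresentation.toSubmodule h)⟩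
  eq_bot_or_eq_top p := or_iff_not_imp_left.2 fun hp =>
    Subrepresentation.toSubmodule_injective <|
      h p.toSubmodule (fun g _ hv => p.apply_mem_toSubmodule g hv) fun h0 =>
        hp (Subrepresentation.toSubmodule_injective h0)

theorem IsIrreducible.of_forall_exists_smul_eq {G' : Type*} [Monoid G'] (ρ : Representation k G V)
    (ρ' : Representation k G' V) [IsIrreducible ρ]
    (h : ∀ g, ∃ (g' : G') (c : k), ρ g = c • ρ' g') : IsIrreducible ρ' := by
  have := IsIrreducible.nontrivial ρ
  refine .of_forall_eq_top ρ' fun p hp hp0 => ?_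
  obtain ⟨v, hv, hv0⟩ := p.exists_mem_ne_zero_of_ne_bot hp0
  refine IsIrreducible.eq_top_of_mem ρ p (fun g v hv => ?_) hv hv0
  obtain ⟨g', c, hg⟩ := h g
  rw [hg]
  exact p.smul_mem c (hp g' v hv)

end Irreducible

section Simple

variable {G : Type} [Group G]

theorem isIrreducible_of_simple (V : FDRep ℂ G) [Simple V] : IsIrreducible V.ρ where
  exists_pair_ne := by
    refine ⟨⊥, ⊤, fun h => id_nonzero V ?_⟩
    have hz : ∀ v : V, v = 0 := fun v => by
      have hv : v ∈ (⊥ : Subrepresentation V.ρ) := h ▸ (Submodule.mem_top : v ∈ (⊤ : Submodule ℂ V))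
      exact hv
    ext v
    exact (hz _).trans (hz _).symm
  eq_bot_or_eq_top p := by
    let i : FDRep.of p.toRepresentation ⟶ V :=
      { hom := FGModuleCat.ofHom p.toSubmodule.subtype
        comm := fun g => by ext v; rfl }
    have hi : Function.Injective i.hom := Subtype.val_injective
    have : Mono i := by
      have : Mono i.hom := ConcreteCategory.mono_of_injective _ hi
      exact (Action.forget _ _).mono_of_mono_map this
    by_cases h0 : i = 0
    · left
      refine le_antisymm (fun v hv => ?_) bot_le
      have : i.hom ⟨v, hv⟩ = 0 := by rw [h0]; rfl
      exact this
    · right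
      have := isIso_of_mono_of_nonzero h0
      refine le_antisymm le_top (fun v _ => ?_)
      have hv : i.hom ((inv i).hom v) = v := by
        have := congrArg (fun f : V ⟶ V => f.hom v) (IsIso.inv_hom_id i)
        exact this
      rw [← hv]
      exact Subtype.property ((inv i).hom v : p.toSubmodule)

variable [Fintype G] {V : Type} [AddCommGroup V] [Module ℂ V] [FiniteDimensional ℂ V]

theorem isIrreducible_of_sum_character (ρ : Representation ℂ G V)
    (h : ∑ g : G, ρ.character g * ρ.character g⁻¹ = Nat.card G) : IsIrreducible ρ := by
  have : Simple (FDRep.of ρ) := (FDRep.simple_iff_char_is_norm_one (FDRep.of ρ)).2 h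
  exact isIrreducible_of_simple (FDRep.of ρ)

end Simple

section Char

variable {G V : Type*} [Group G] [Finite G] [AddCommGroup V] [Module ℂ V] [FiniteDimensional ℂ V]

open Matrix ComplexOrder in
theorem character_inv (ρ : Representation ℂ G V) (g : G) :
    ρ.character g⁻¹ = starRingEnd ℂ (ρ.character g) := by
  have := Fintype.ofFinite G
  let b := Module.finBasis ℂ V
  let A : G →* Matrix (Fin (finrank ℂ V)) (Fin (finrank ℂ V)) ℂ :=
    ((LinearMap.toMatrixAlgEquiv b : (V →ₗ[ℂ] V) ≃ₐ[ℂ] _) : (V →ₗ[ℂ] V) →* _).comp ρ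
  have hA : ∀ x, ρ.character x = (A x).trace := fun x => LinearMap.trace_eq_matrix_trace ℂ b (ρ x)
  let P := ∑ x : G, (A x)ᴴ * A x
  have hP : P.PosDef := by
    refine posDef_sum Finset.univ_nonempty fun x _ => ?_
    refine PosDef.conjTranspose_mul_self _ (mulVec_injective_of_isUnit ?_)
    exact (Group.isUnit x).map A
  have hinv : (A g)ᴴ * P * A g = P := by
    simp only [P, Finset.mul_sum, Finset.sum_mul]
    refine Fintype.sum_equiv (Equiv.mulRight g) _ _ fun x => ?_
    simp [Matrix.mul_assoc]
  have hu := (Matrix.isUnit_iff_isUnit_det _).1 hP.isUnit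
  have hgg : A g * A g⁻¹ = 1 := by rw [← map_mul]; simp
  have hPg : (A g)ᴴ * P = P * A g⁻¹ := by
    calc (A g)ᴴ * P = (A g)ᴴ * P * (A g * A g⁻¹) := by rw [hgg, Matrix.mul_one]
      _ = ((A g)ᴴ * P * A g) * A g⁻¹ := by simp only [Matrix.mul_assoc]
      _ = P * A g⁻¹ := by rw [hinv]
  rw [hA, hA, starRingEnd_apply, ← trace_conjTranspose]
  calc (A g⁻¹).trace = (P⁻¹ * (P * A g⁻¹)).trace := by
        rw [← Matrix.mul_assoc, Matrix.nonsing_inv_mul _ hu, Matrix.one_mul]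
    _ = ((A g)ᴴ).trace := by
        rw [← hPg, Matrix.trace_mul_comm, Matrix.mul_assoc, Matrix.mul_nonsing_inv _ hu,
          Matrix.mul_one]

end Char

section Schur

variable {k G V W : Type*} [Group G] [Field k] [AddCommGroup V] [Module k V]
  [AddCommGroup W] [Module k W]

theorem IsIrreducible.exists_eq_smul_of_comm [IsAlgClosed k] [FiniteDimensional k V]
    (ρ : Representation k G V) [IsIrreducible ρ]
    (A : V →ₗ[k] V) (hA : ∀ g v, A (ρ g v) = ρ g (A v)) : ∃ c : k, ∀ v, A v = c • v := by
  obtain ⟨c, hc⟩ := (IsIrreducible.algebraMap_intertwiningMap_bijective_of_isAlgClosed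
    (ρ := ρ)).2 (A.intertwiningMap_of_isIntertwiningMap ρ ρ hA)
  exact ⟨c, fun v => congrArg (fun f : IntertwiningMap ρ ρ => f v) hc.symm⟩

variable [Fintype G]

/-- Up to a scalar, the action of the central idempotent of `k[G]` attached to `α`. -/
noncomputable def characterSum (α : Representation k G V) (β : Representation k G W) : W →ₗ[k] W :=
  ∑ x : G, α.character x⁻¹ • β x

theorem characterSum_apply (α : Representation k G V) (β : Representation k G W) (w : W) :
    characterSum α β w = ∑ x : G, α.character x⁻¹ • β x w := by
  simp [characterSum]

theorem characterSum_comm (α : Representation k G V) (β : Representation k G W) (g : G) (w : W) :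
    characterSum α β (β g w) = β g (characterSum α β w) := by
  simp only [characterSum_apply, map_sum, map_smul]
  refine Fintype.sum_equiv (MulAut.conj g⁻¹).toEquiv _ _ fun x => ?_
  have h1 : α.character (g⁻¹ * x * g)⁻¹ = α.character x⁻¹ := by
    rw [← α.char_conj x⁻¹ g⁻¹]; congr 1; group
  simp only [MulEquiv.toEquiv_eq_coe, EquivLike.coe_coe, MulAut.conj_apply, inv_inv, h1,
    ← Module.End.mul_apply, ← map_mul]
  congr 3; group

theorem trace_characterSum (α : Representation k G V) (β : Representation k G W) :
    LinearMap.trace k W (characterSum α β) = ∑ x : G, β.character x * α.character x⁻¹ := by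
  simp [characterSum, character, mul_comm]

theorem characterSum_apply_of_map {β : Representation k G W} {U : Type*} [AddCommGroup U]
    [Module k U] (α : Representation k G V) {γ : Representation k G U}
    (f : W →ₗ[k] U) (hf : ∀ g w, f (β g w) = γ g (f w)) (w : W) :
    characterSum α γ (f w) = f (characterSum α β w) := by
  simp [characterSum_apply, hf]

variable [IsAlgClosed k] [CharZero k] [FiniteDimensional k V]

theorem characterSum_eq_zero [FiniteDimensional k W] (α : Representation k G V) (β : Representation k G W)
    [IsIrreducible α] [IsIrreducible β] (h : α.character ≠ β.character) (w : W) :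
    characterSum α β w = 0 := by
  have := invertibleOfNonzero (NeZero.ne (Nat.card G : k))
  obtain ⟨c, hc⟩ := IsIrreducible.exists_eq_smul_of_comm β _ (characterSum_comm α β)
  have h0 := char_orthonormal β α
  rw [if_neg (fun ⟨e⟩ => h (char_iso e)), ← trace_characterSum,
    show characterSum α β = c • LinearMap.id from LinearMap.ext hc] at h0
  have := IsIrreducible.nontrivial β
  have hW : (finrank k W : k) ≠ 0 := Nat.cast_ne_zero.2 finrank_pos.ne'
  have hc0 : c = 0 := by simpa [hW] using h0
  rw [hc, hc0, zero_smul]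

theorem exists_characterSum_eq_smul (α : Representation k G V) [IsIrreducible α] :
    ∃ c : k, c ≠ 0 ∧ ∀ v, characterSum α α v = c • v := by
  have := invertibleOfNonzero (NeZero.ne (Nat.card G : k))
  obtain ⟨c, hc⟩ := IsIrreducible.exists_eq_smul_of_comm α _ (characterSum_comm α α)
  refine ⟨c, ?_, hc⟩
  rintro rfl
  have h0 := char_orthonormal α α
  rw [if_pos ⟨Equiv.refl α⟩, ← trace_characterSum,
    show characterSum α α = 0 from LinearMap.ext (by simpa using hc)] at h0
  simp at h0

theorem nonempty_equiv_of_character_eq [FiniteDimensional k W] (α : Representation k G V)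
    (β : Representation k G W) [IsIrreducible α] [IsIrreducible β]
    (h : α.character = β.character) : Nonempty (Equiv α β) := by
  have := invertibleOfNonzero (NeZero.ne (Nat.card G : k))
  by_contra he
  have h0 := char_orthonormal β α
  have h1 := char_orthonormal β β
  rw [if_neg he, h] at h0
  rw [if_pos ⟨Equiv.refl β⟩, h0] at h1
  exact zero_ne_one h1

end Schur

section Eigenvector

variable {k G M : Type*} [Group G] [Finite G] [Field k] [CharZero k]
  [AddCommGroup M] [Module k M]

theorem isSemisimple_apply_of_finite (π : Representation k G M) (g : G) :
    Module.End.IsSemisimple (π g) := by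
  have hn : ((orderOf g : ℕ) : k) ≠ 0 := Nat.cast_ne_zero.2 (orderOf_pos g).ne'
  refine Module.End.isSemisimple_of_squarefree_aeval_eq_zero
    (Polynomial.X_pow_sub_one_separable_iff.2 hn).squarefree ?_
  rw [map_sub, map_one, map_pow, Polynomial.aeval_X, ← map_pow, pow_orderOf_eq_one, map_one,
    sub_self]

variable [IsAlgClosed k] [FiniteDimensional k M]

theorem exists_forall_apply_eq_smul_of_commute [Nontrivial M] (π : Representation k G M)
    (h : ∀ a b, Commute (π a) (π b)) :
    ∃ v : M, v ≠ 0 ∧ ∃ c : G → k, ∀ g, π g v = c g • v := by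
  have htop := Module.End.iSup_iInf_maxGenEigenspace_eq_top_of_iSup_maxGenEigenspace_eq_top_of_commute
    (fun g => π g) (fun a b _ => h a b) (fun g => Module.End.iSup_maxGenEigenspace_eq_top _)
  obtain ⟨c, hc⟩ : ∃ c : G → k, ⨅ g, Module.End.maxGenEigenspace (π g) (c g) ≠ ⊥ := by
    by_contra hbot
    simp only [not_exists, not_not] at hbot
    exact bot_ne_top ((iSup_eq_bot.2 hbot).symm.trans htop)
  obtain ⟨v, hv, hv0⟩ := Submodule.exists_mem_ne_zero_of_ne_bot hc
  refine ⟨v, hv0, c, fun g => ?_⟩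
  have hvg := (Submodule.mem_iInf _).1 hv g
  rw [((isSemisimple_apply_of_finite π g).isFinitelySemisimple).maxGenEigenspace_eq_eigenspace]
    at hvg
  exact Module.End.mem_eigenspace_iff.1 hvg

theorem exists_forall_apply_eq_smul_of_commutator_le (π : Representation k G M) (N : Subgroup G)
    (hN : commutator G ≤ N) {v₀ : M} (hv₀ : v₀ ≠ 0) (hfix : ∀ n ∈ N, π n v₀ = v₀) :
    ∃ v : M, v ≠ 0 ∧ (∀ n ∈ N, π n v = v) ∧ ∃ c : G → k, ∀ g, π g v = c g • v := by
  have hN' : ∀ a b : G, a⁻¹ * b⁻¹ * a * b ∈ N := fun a b => by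
    simpa [commutatorElement_def] using
      hN (Subgroup.commutator_mem_commutator (Subgroup.mem_top a⁻¹) (Subgroup.mem_top b⁻¹))
  let p : Subrepresentation π :=
    { toSubmodule := ⨅ n : N, LinearMap.eqLocus (π n) LinearMap.id
      apply_mem_toSubmodule := fun g v hv => by
        simp only [Submodule.mem_iInf, LinearMap.mem_eqLocus, LinearMap.id_apply] at hv ⊢
        intro n
        have h1 : (n : G) * g = g * (n * ((n : G)⁻¹ * g⁻¹ * n * g)) := by group
        have h2 := hv ⟨_, N.mul_mem n.2 (hN' n g)⟩
        rw [← Module.End.mul_apply, ← map_mul, h1, map_mul, Module.End.mul_apply, h2] }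
  have hp : ∀ v, v ∈ p.toSubmodule ↔ ∀ n ∈ N, π n v = v := by simp [p]
  have : Nontrivial p.toSubmodule :=
    ⟨⟨v₀, (hp _).2 hfix⟩, 0, fun h => hv₀ (congrArg Subtype.val h)⟩
  obtain ⟨v, hv0, c, hc⟩ := exists_forall_apply_eq_smul_of_commute p.toRepresentation
    fun a b => LinearMap.ext fun v => Subtype.ext <| by
      change π a (π b v) = π b (π a v)
      have h1 : a * b = b * a * (a⁻¹ * b⁻¹ * a * b) := by group
      rw [← Module.End.mul_apply, ← map_mul, h1, map_mul, Module.End.mul_apply,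
        (hp v).1 v.2 _ (hN' a b), map_mul, Module.End.mul_apply]
  exact ⟨v, fun h => hv0 (Subtype.ext h), (hp v).1 v.2, c, fun g => congrArg Subtype.val (hc g)⟩

end Eigenvector

section Clifford

variable {k T W E : Type*} [Group T] [Field k] [AddCommGroup W] [Module k W] [AddCommGroup E]
  [Module k E] {H S : Subgroup T}

/-- The restriction of a representation of `S` to a smaller subgroup `H`. -/
abbrev restrictLE (σ : Representation k S W) (hHS : H ≤ S) : Representation k H W :=
  MonoidHom.comp σ (Subgroup.inclusion hHS)

/-- The restriction of a representation of a group to a subgroup. -/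
abbrev restrictSubgroup (ρ : Representation k T E) (H : Subgroup T) : Representation k H E :=
  MonoidHom.comp ρ H.subtype

variable [IsAlgClosed k] [CharZero k] [FiniteDimensional k W]

theorem exists_semiequivariant [FiniteDimensional k E] [Finite T] (hHS : H ≤ S) (hab : commutator T ≤ H)
    (σ : Representation k S W) (ρ : Representation k T E) {f₀ : W →ₗ[k] E} (hf₀ : f₀ ≠ 0)
    (hf₀H : ∀ x w, f₀ (σ.restrictLE hHS x w) = ρ.restrictSubgroup H x (f₀ w)) :
    ∃ f : W →ₗ[k] E, f ≠ 0 ∧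
      (∀ x w, f (σ.restrictLE hHS x w) = ρ.restrictSubgroup H x (f w)) ∧
      ∃ c : S → k, ∀ (s : S) w, ρ s (f w) = c s • f (σ s w) := by
  obtain ⟨f, hf0, hfix, c, hc⟩ := exists_forall_apply_eq_smul_of_commutator_le
    (linHom σ (ρ.restrictSubgroup S)) (H.subgroupOf S) (by
      refine Subgroup.map_le_iff_le_comap.1 (le_trans ?_ hab)
      rw [Subgroup.map_subtype_commutator]
      exact Subgroup.commutator_mono le_top le_top) hf₀ (by
      rintro ⟨n, hnS⟩ hn
      ext w
      have hn' : n⁻¹ ∈ H := H.inv_mem hn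
      have := hf₀H ⟨n⁻¹, hn'⟩ w
      change ρ n (f₀ (σ ⟨n⁻¹, hHS hn'⟩ w)) = f₀ w
      rw [show f₀ (σ ⟨n⁻¹, hHS hn'⟩ w) = ρ n⁻¹ (f₀ w) from this, self_inv_apply])
  refine ⟨f, hf0, fun x w => ?_, c, fun s w => ?_⟩
  · have h1 := hfix ⟨x, hHS x.2⟩ x.2
    have h2 := LinearMap.congr_fun h1 (σ ⟨x, hHS x.2⟩ w)
    change ρ x (f (σ ⟨x, hHS x.2⟩⁻¹ (σ ⟨x, hHS x.2⟩ w))) = _ at h2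
    rw [inv_self_apply] at h2
    exact h2.symm
  · have h2 := LinearMap.congr_fun (hc s) (σ s w)
    change ρ s (f (σ s⁻¹ (σ s w))) = _ at h2
    rw [inv_self_apply] at h2
    exact h2

variable [Fintype H] [H.Normal] {hHS : H ≤ S} {σ : Representation k S W}
  {ρ : Representation k T E} [IsIrreducible (σ.restrictLE hHS)]
  {f : W →ₗ[k] E} {c : S → k}

theorem characterSum_apply_eq_zero_of_notMem
    (hS : ∀ g, g ∈ S ↔ ∀ x : H, (σ.restrictLE hHS).character (MulAut.conjNormal g x) =
      (σ.restrictLE hHS).character x)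
    (hfH : ∀ x w, f (σ.restrictLE hHS x w) = ρ.restrictSubgroup H x (f w))
    {t : T} (ht : t ∉ S) (w : W) :
    characterSum (σ.restrictLE hHS) (ρ.restrictSubgroup H) (ρ t (f w)) = 0 := by
  set α := σ.restrictLE hHS
  let α' : Representation k H W := MonoidHom.comp α (MulAut.conjNormal t⁻¹ : H ≃* H).toMonoidHom
  have : IsIrreducible α' := .of_forall_exists_smul_eq α α' fun g =>
    ⟨MulAut.conjNormal t g, 1, by
      rw [one_smul]
      change α g = α (MulAut.conjNormal t⁻¹ (MulAut.conjNormal t g))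
      rw [map_inv, MulAut.inv_apply_self]⟩
  have hne : α.character ≠ α'.character := fun h =>
    ht (inv_mem_iff.1 ((hS t⁻¹).2 fun x => (congrFun h x).symm))
  have := characterSum_apply_of_map (γ := ρ.restrictSubgroup H) (β := α') α (ρ t ∘ₗ f)
    (fun x w => by
      change ρ t (f (α (MulAut.conjNormal t⁻¹ x) w)) = ρ x (ρ t (f w))
      rw [hfH]
      change ρ t (ρ ((MulAut.conjNormal t⁻¹ x : H) : T) (f w)) = _
      rw [MulAut.conjNormal_apply, ← Module.End.mul_apply, ← map_mul, ← Module.End.mul_apply,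
        ← map_mul]
      congr 2
      group) w
  rw [characterSum_eq_zero α α' hne, map_zero] at this
  exact this

theorem characterSum_mem_range [IsIrreducible ρ]
    (hS : ∀ g, g ∈ S ↔ ∀ x : H, (σ.restrictLE hHS).character (MulAut.conjNormal g x) =
      (σ.restrictLE hHS).character x)
    (hf0 : f ≠ 0) (hfH : ∀ x w, f (σ.restrictLE hHS x w) = ρ.restrictSubgroup H x (f w))
    (hfS : ∀ (s : S) w, ρ s (f w) = c s • f (σ s w)) (v : E) :
    characterSum (σ.restrictLE hHS) (ρ.restrictSubgroup H) v ∈ LinearMap.range f := by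
  set e := characterSum (σ.restrictLE hHS) (ρ.restrictSubgroup H)
  let p : Submodule k E := ⨅ t, (LinearMap.range f).comap (e ∘ₗ ρ t)
  have hp : ∀ v, v ∈ p ↔ ∀ t, e (ρ t v) ∈ LinearMap.range f := by simp [p]
  obtain ⟨w, hw⟩ : ∃ w, f w ≠ 0 := by
    by_contra! h
    exact hf0 (LinearMap.ext h)
  have hfp : f w ∈ p := (hp _).2 fun t => by
    by_cases ht : t ∈ S
    · rw [show ρ t (f w) = c ⟨t, ht⟩ • f (σ ⟨t, ht⟩ w) from hfS ⟨t, ht⟩ w, map_smul,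
        characterSum_apply_of_map _ f hfH]
      exact Submodule.smul_mem _ _ (LinearMap.mem_range_self _ _)
    · rw [characterSum_apply_eq_zero_of_notMem hS hfH ht]
      exact Submodule.zero_mem _
  have htop := IsIrreducible.eq_top_of_mem ρ p (fun g v hv => (hp _).2 fun t => by
    rw [← Module.End.mul_apply (ρ t), ← map_mul]
    exact (hp v).1 hv _) hfp hw
  have hv := (hp v).1 (htop ▸ Submodule.mem_top) 1
  rwa [map_one] at hv

theorem trace_apply_comp_characterSum_eq_zero [FiniteDimensional k E] [IsIrreducible ρ]
    (hS : ∀ g, g ∈ S ↔ ∀ x : H, (σ.restrictLE hHS).character (MulAut.conjNormal g x) =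
      (σ.restrictLE hHS).character x)
    (hf0 : f ≠ 0) (hfH : ∀ x w, f (σ.restrictLE hHS x w) = ρ.restrictSubgroup H x (f w))
    (hfS : ∀ (s : S) w, ρ s (f w) = c s • f (σ s w)) {g : T} (hg : g ∉ S) :
    LinearMap.trace k E
      (ρ g ∘ₗ characterSum (σ.restrictLE hHS) (ρ.restrictSubgroup H)) = 0 := by
  refine (LinearMap.isNilpotent_trace_of_isNilpotent ⟨2, LinearMap.ext fun v => ?_⟩).eq_zero
  obtain ⟨w, hw⟩ := characterSum_mem_range hS hf0 hfH hfS v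
  rw [pow_two, Module.End.mul_apply, LinearMap.comp_apply, LinearMap.comp_apply, ← hw,
    characterSum_apply_eq_zero_of_notMem hS hfH hg, map_zero, LinearMap.zero_apply]

theorem character_eq_zero_of_notMem [FiniteDimensional k E] [Finite T] [IsIrreducible ρ] [S.Normal]
    (hS : ∀ g, g ∈ S ↔ ∀ x : H, (σ.restrictLE hHS).character (MulAut.conjNormal g x) =
      (σ.restrictLE hHS).character x)
    (hf0 : f ≠ 0) (hfH : ∀ x w, f (σ.restrictLE hHS x w) = ρ.restrictSubgroup H x (f w))
    (hfS : ∀ (s : S) w, ρ s (f w) = c s • f (σ s w))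
    (htr : LinearMap.trace k E
      (characterSum (σ.restrictLE hHS) (ρ.restrictSubgroup H)) ≠ 0)
    {g : T} (hg : g ∉ S) : ρ.character g = 0 := by
  have := Fintype.ofFinite T
  set e := characterSum (σ.restrictLE hHS) (ρ.restrictSubgroup H)
  let A : E →ₗ[k] E := ∑ t : T, ρ t * e * ρ t⁻¹
  obtain ⟨a, ha⟩ := IsIrreducible.exists_eq_smul_of_comm ρ A fun t v => by
    simp only [A, LinearMap.sum_apply, map_sum, Module.End.mul_apply]
    refine Fintype.sum_equiv (Equiv.mulLeft t⁻¹) _ _ fun u => ?_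
    simp [map_mul]
  have hA : A = a • 1 := LinearMap.ext ha
  have hconj : ∀ u t : T, LinearMap.trace k E (ρ u * (ρ t * e * ρ t⁻¹)) =
      LinearMap.trace k E (ρ (t⁻¹ * u * t) * e) := fun u t => by
    rw [← mul_assoc, LinearMap.trace_mul_comm]
    simp only [map_mul, mul_assoc]
  have ha0 : a ≠ 0 := by
    rintro rfl
    have h1 : LinearMap.trace k E (ρ 1 * A) = 0 := by rw [hA]; simp
    simp only [A, Finset.mul_sum, map_sum, hconj] at h1
    simp [htr] at h1
  have h1 : LinearMap.trace k E (ρ g * A) = 0 := by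
    simp only [A, Finset.mul_sum, map_sum, hconj]
    refine Finset.sum_eq_zero fun t _ => ?_
    refine trace_apply_comp_characterSum_eq_zero hS hf0 hfH hfS fun h => hg ?_
    simpa [mul_assoc] using Subgroup.Normal.conj_mem ‹S.Normal› _ h t
  rw [hA, mul_smul_comm, mul_one, map_smul, smul_eq_mul] at h1
  exact (mul_eq_zero.1 h1).resolve_left ha0

theorem exists_eq_smul_of_equivariant [IsIrreducible ρ]
    (hS : ∀ g, g ∈ S ↔ ∀ x : H, (σ.restrictLE hHS).character (MulAut.conjNormal g x) =
      (σ.restrictLE hHS).character x)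
    (hf0 : f ≠ 0) (hfH : ∀ x w, f (σ.restrictLE hHS x w) = ρ.restrictSubgroup H x (f w))
    (hfS : ∀ (s : S) w, ρ s (f w) = c s • f (σ s w))
    (f' : W →ₗ[k] E) (hf' : ∀ x w, f' (σ.restrictLE hHS x w) = ρ.restrictSubgroup H x (f' w)) :
    ∃ a : k, ∀ w, f' w = a • f w := by
  set α := σ.restrictLE hHS
  have hinj : Function.Injective f :=
    (IsIrreducible.injective_or_eq_zero (f.intertwiningMap_of_isIntertwiningMap α _ hfH)).resolve_right
      fun h => hf0 (congrArg IntertwiningMap.toLinearMap h)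
  obtain ⟨g, hg⟩ := f.exists_leftInverse_of_injective (LinearMap.ker_eq_bot.2 hinj)
  obtain ⟨b, hb0, hb⟩ := exists_characterSum_eq_smul α
  have hfg : ∀ w, f (g (f' w)) = f' w := fun w => by
    have hmem := characterSum_mem_range hS hf0 hfH hfS (f' w)
    rw [characterSum_apply_of_map _ f' hf', hb, map_smul,
      Submodule.smul_mem_iff _ hb0] at hmem
    obtain ⟨u, hu⟩ := hmem
    rw [← hu, show g (f u) = u from LinearMap.congr_fun hg u]
  obtain ⟨a, ha⟩ := IsIrreducible.exists_eq_smul_of_comm α (g ∘ₗ f') fun x w => hinj <| by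
    simp only [LinearMap.comp_apply]
    rw [hfg, hf', hfH, hfg]
  exact ⟨a, fun w => by rw [← hfg, ← LinearMap.comp_apply g f', ha, map_smul]⟩

theorem eq_one_of_mem_of_twist [IsIrreducible ρ]
    (hS : ∀ g, g ∈ S ↔ ∀ x : H, (σ.restrictLE hHS).character (MulAut.conjNormal g x) =
      (σ.restrictLE hHS).character x)
    (hf0 : f ≠ 0) (hfH : ∀ x w, f (σ.restrictLE hHS x w) = ρ.restrictSubgroup H x (f w))
    (hfS : ∀ (s : S) w, ρ s (f w) = c s • f (σ s w))
    {μ : T → k} (hμ : ∀ x ∈ H, μ x = 1) {φ : E →ₗ[k] E} (hφ : Function.Injective φ)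
    (hφμ : ∀ t v, φ (ρ t v) = μ t • ρ t (φ v)) {s : T} (hs : s ∈ S) : μ s = 1 := by
  obtain ⟨a, ha⟩ := exists_eq_smul_of_equivariant hS hf0 hfH hfS (φ ∘ₗ f) fun x w => by
    rw [LinearMap.comp_apply, hfH]
    exact (hφμ x (f w)).trans (by rw [hμ x x.2, one_smul]; rfl)
  replace ha : ∀ w, φ (f w) = a • f w := ha
  obtain ⟨w, hw⟩ : ∃ w, f w ≠ 0 := by
    by_contra! h
    exact hf0 (LinearMap.ext h)
  have ha0 : a ≠ 0 := by
    rintro rfl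
    exact hw (hφ (by rw [ha, zero_smul, map_zero]))
  have h1 : φ (ρ s (f w)) = a • ρ s (f w) := by
    rw [hfS ⟨s, hs⟩ w, map_smul, ha, smul_comm]
  rw [hφμ, ha, map_smul] at h1
  have hX : a • ρ s (f w) ≠ 0 :=
    smul_ne_zero ha0 ((map_ne_zero_iff _ (ρ.apply_bijective s).injective).2 hw)
  exact smul_left_injective k hX (h1.trans (one_smul k _).symm)

end Clifford

section Twist

variable {k G V : Type*} [Group G] [Field k] [AddCommGroup V] [Module k V]

/-- The tensor product of a representation with a linear character. -/
def twist (ρ : Representation k G V) (μ : G →* kˣ) : Representation k G V where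
  toFun g := (μ g : k) • ρ g
  map_one' := by simp
  map_mul' a b := by rw [map_mul, map_mul, Units.val_mul, smul_mul_smul_comm]

theorem twist_apply (ρ : Representation k G V) (μ : G →* kˣ) (g : G) (v : V) :
    ρ.twist μ g v = (μ g : k) • ρ g v := rfl

theorem character_twist (ρ : Representation k G V) (μ : G →* kˣ) (g : G) :
    (ρ.twist μ).character g = ρ.character g * μ g := by
  simp [twist, character, mul_comm]

theorem isIrreducible_twist (ρ : Representation k G V) [IsIrreducible ρ] (μ : G →* kˣ) :
    IsIrreducible (ρ.twist μ) :=
  .of_forall_exists_smul_eq ρ _ fun g => ⟨g, ((μ g)⁻¹ : kˣ), by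
    ext v
    simp [twist_apply, smul_smul]⟩

end Twist

end Representation

theorem exists_monoidHom_units_apply_ne_one_of_notMem {T : Type*} [Group T] [Finite T] {S : Subgroup T}
    [S.Normal] (hS : commutator T ≤ S) {g : T} (hg : g ∉ S) :
    ∃ μ : T →* ℂˣ, S ≤ μ.ker ∧ μ g ≠ 1 := by
  let _ : CommGroup (T ⧸ S) :=
    { (inferInstance : Group (T ⧸ S)) with
      mul_comm := fun a b => by
        induction a using QuotientGroup.induction_on with | _ a
        induction b using QuotientGroup.induction_on with | _ b
        refine QuotientGroup.eq.2 ?_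
        have h := hS (Subgroup.commutator_mem_commutator (Subgroup.mem_top b⁻¹)
          (Subgroup.mem_top a⁻¹))
        simpa [commutatorElement_def, mul_assoc] using h }
  obtain ⟨φ, hφ⟩ := CommGroup.exists_apply_ne_one_of_hasEnoughRootsOfUnity (T ⧸ S) ℂ
    (a := (g : T ⧸ S)) (fun h => hg ((QuotientGroup.eq_one_iff g).1 h))
  refine ⟨φ.comp (QuotientGroup.mk' S), fun s hs => ?_, hφ⟩
  rw [MonoidHom.mem_ker, MonoidHom.comp_apply, QuotientGroup.mk'_apply,
    (QuotientGroup.eq_one_iff s).2 hs, map_one]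

open Representation in
/-- Let `H ⊴ T` with `T/H` abelian, let `χ` (the character of the simple
complex representation `V` of `H`) extend to its stabilizer `S = T_χ`, and let `χ̃` (the
character of the simple representation `Vt` of `T`) lie over `χ`.  Then
`S = ⋂ ker μ`, the intersection running over all homomorphisms `μ : T → ℂˣ` with
`H ≤ ker μ` and `χ̃·μ = χ̃`. -/
theorem stabilizer_eq_iInter_ker {T : Type} [Group T] [Finite T]
    (H : Subgroup T) [H.Normal] (hab : ∀ a b : T ⧸ H, a * b = b * a)
    (V : FDRep ℂ H) (hV : Simple V)
    (S : Subgroup T)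
    (hS : ∀ g : T, g ∈ S ↔ ∀ x : H, V.character (MulAut.conjNormal g x) = V.character x)
    (hHS : H ≤ S)
    (hext : ∃ W : FDRep ℂ S, Simple W ∧
      ∀ (x : T) (hx : x ∈ H), W.character ⟨x, hHS hx⟩ = V.character ⟨x, hx⟩)
    (Vt : FDRep ℂ T) (hVt : Simple Vt)
    (hover : (∑ᶠ x : H, Vt.character (x : T) * (starRingEnd ℂ) (V.character x)) ≠ 0) :
    ∀ g : T, g ∈ S ↔
      ∀ μ : T →* ℂˣ, H ≤ μ.ker →
        (∀ t : T, Vt.character t * (μ t : ℂ) = Vt.character t) → μ g = 1 := by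
  have hcomm : commutator T ≤ H :=
    Subgroup.commutator_le.2 fun a _ b _ => by
      rw [← QuotientGroup.eq_one_iff, commutatorElement_def]
      simp [hab (a : T ⧸ H) b]
  have hSn : S.Normal := ⟨fun s hs g => by
    have h := S.mul_mem (hHS (hcomm (Subgroup.commutator_mem_commutator (Subgroup.mem_top g)
      (Subgroup.mem_top s)))) hs
    simpa [commutatorElement_def] using h⟩
  have := Fintype.ofFinite T
  have := Fintype.ofFinite H
  have := invertibleOfNonzero (NeZero.ne (Nat.card H : ℂ))
  obtain ⟨W, -, hW⟩ := hext
  let σ : Representation ℂ S W := W.ρ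
  let ρ : Representation ℂ T Vt := Vt.ρ
  have hχ : (σ.restrictLE hHS).character = V.character := funext fun x => hW x x.2
  have hρ : IsIrreducible ρ := isIrreducible_of_simple Vt
  have hσ : IsIrreducible (σ.restrictLE hHS) := isIrreducible_of_sum_character _ <| by
    simpa only [hχ] using (FDRep.simple_iff_char_is_norm_one V).1 hV
  have hsum : ∑ x : H, (ρ.restrictSubgroup H).character x *
      (σ.restrictLE hHS).character x⁻¹ ≠ 0 := by
    rw [finsum_eq_sum_of_fintype] at hover
    simp only [character_inv, hχ]
    exact hover
  obtain ⟨f₀, hf₀⟩ : ∃ f₀ : IntertwiningMap (σ.restrictLE hHS) (ρ.restrictSubgroup H), f₀ ≠ 0 := by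
    by_contra! h
    have : Subsingleton (IntertwiningMap (σ.restrictLE hHS) (ρ.restrictSubgroup H)) :=
      ⟨fun a b => (h a).trans (h b).symm⟩
    have h0 := card_inv_mul_sum_char_mul_char_eq_finrank (σ.restrictLE hHS) (ρ.restrictSubgroup H)
    rw [Module.finrank_zero_of_subsingleton, Nat.cast_zero] at h0
    exact mul_ne_zero (inv_ne_zero (NeZero.ne _)) hsum h0
  obtain ⟨f, hf0, hfH, c, hfS⟩ := exists_semiequivariant hHS hcomm σ ρ
    (fun h => hf₀ (IntertwiningMap.ext h)) f₀.isIntertwining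
  rw [← hχ] at hS
  intro g
  constructor
  · intro hg μ hμ hμt
    have := isIrreducible_twist ρ μ
    obtain ⟨φ⟩ := nonempty_equiv_of_character_eq ρ (ρ.twist μ)
      (funext fun t => ((character_twist ρ μ t).trans (hμt t)).symm)
    exact Units.ext <| eq_one_of_mem_of_twist hS hf0 hfH hfS (μ := fun t => (μ t : ℂ))
      (fun x hx => congrArg Units.val (hμ hx)) (φ := φ.toLinearEquiv.toLinearMap)
      φ.toLinearEquiv.injective (fun t v => φ.toIntertwiningMap.isIntertwining _ _ t v) hg
  · intro h
    by_contra hg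
    obtain ⟨μ, hμS, hμg⟩ := exists_monoidHom_units_apply_ne_one_of_notMem (hcomm.trans hHS) hg
    refine hμg (h μ (hHS.trans hμS) fun t => ?_)
    by_cases ht : t ∈ S
    · rw [(hμS ht : μ t = 1), Units.val_one, mul_one]
    · have h0 : Vt.character t = 0 := character_eq_zero_of_notMem (ρ := ρ) hS hf0 hfH hfS
        (by rw [trace_characterSum]; exact hsum) ht
      rw [h0, zero_mul]
end
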